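/- Let K^d = {x ∈ ℝ^d : x_i ≥ 0 for all i, Σ_i x_i ≤ 1} be the unit simplex and let C_{p,d} be the best constant such that ‖∂v/∂x_i‖_{L²(K^d)} ≤ C_{p,d} ‖v‖_{L²(K^d)} for all polynomials v of total degree at most p and all i. Then C_{p,d} ≤ (√5/4)·(2√2)^d · C_{p,1}, where C_{p,1} is the corresponding best constant for the unit interval. -/

import Mathlib

open MeasureTheory Real

/-- The unit simplex `K^d = {x : ∀ i, 0 ≤ x i, ∑ x i ≤ 1}`. -/
def unitSimplex (d : ℕ) : Set (Fin d → ℝ) :=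
  {x | (∀ i, 0 ≤ x i) ∧ ∑ i, x i ≤ 1}

/-- Chain rule for polynomial substitution. -/
lemma aux_chain {n : ℕ} {B : Type*} [CommRing B] [Algebra ℝ B] (D : Derivation ℝ B B)
    (f : Fin n → B) (v : MvPolynomial (Fin n) ℝ) :
    D (MvPolynomial.aeval f v)
      = ∑ k, MvPolynomial.aeval f (MvPolynomial.pderiv k v) * D (f k) := by
  induction v using MvPolynomial.induction_on with
  | C a => simp
  | add p q hp hq => simp [hp, hq, add_mul, Finset.sum_add_distrib]
  | mul_X p i hp =>
    simp only [map_mul, MvPolynomial.aeval_X, Derivation.leibniz, smul_eq_mul, hp, map_add,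
      MvPolynomial.pderiv_X, add_mul, Finset.sum_add_distrib, Finset.mul_sum]
    congr 1
    · rw [Finset.sum_eq_single i]
      · simp
      · intro b _ hb
        simp [Pi.single_apply, hb.symm]
      · simp
    · exact Finset.sum_congr rfl fun k _ => by ring

lemma aux_totalDegree {m n : ℕ} (f : Fin n → MvPolynomial (Fin m) ℝ)
    (hf : ∀ i, (f i).totalDegree ≤ 1) (v : MvPolynomial (Fin n) ℝ) :
    (MvPolynomial.aeval f v).totalDegree ≤ v.totalDegree := by
  rw [MvPolynomial.aeval_def, MvPolynomial.eval₂_eq]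
  refine (MvPolynomial.totalDegree_finsetSum _ _).trans (Finset.sup_le fun s hs => ?_)
  refine (MvPolynomial.totalDegree_mul _ _).trans ?_
  have h1 : (algebraMap ℝ (MvPolynomial (Fin m) ℝ) (MvPolynomial.coeff s v)).totalDegree = 0 :=
    MvPolynomial.totalDegree_C _
  rw [h1, zero_add]
  refine (MvPolynomial.totalDegree_finsetProd _ _).trans ?_
  refine le_trans ?_ (MvPolynomial.le_totalDegree hs)
  rw [Finsupp.sum]
  refine Finset.sum_le_sum fun i _ => (MvPolynomial.totalDegree_pow _ _).trans ?_
  calc s i * (f i).totalDegree ≤ s i * 1 := Nat.mul_le_mul_left _ (hf i)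
    _ = s i := mul_one _

lemma aux_natDegree {n : ℕ} (f : Fin n → Polynomial ℝ)
    (hf : ∀ i, (f i).natDegree ≤ 1) (v : MvPolynomial (Fin n) ℝ) :
    (MvPolynomial.aeval f v).natDegree ≤ v.totalDegree := by
  have := MvPolynomial.aeval_natDegree_le v (le_refl v.totalDegree) f hf
  simpa using this

lemma aux_eval_aeval {m n : ℕ} (f : Fin n → MvPolynomial (Fin m) ℝ)
    (v : MvPolynomial (Fin n) ℝ) (x : Fin m → ℝ) :
    MvPolynomial.eval x (MvPolynomial.aeval f v)
      = MvPolynomial.eval (fun i => MvPolynomial.eval x (f i)) v := by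
  induction v using MvPolynomial.induction_on with
  | C a => simp
  | add p q hp hq => rw [map_add, map_add, map_add, hp, hq]
  | mul_X p i hp =>
    rw [map_mul, map_mul, map_mul, hp, MvPolynomial.aeval_X, MvPolynomial.eval_X]

lemma aux_eval_aeval' {n : ℕ} (f : Fin n → Polynomial ℝ)
    (v : MvPolynomial (Fin n) ℝ) (x : ℝ) :
    Polynomial.eval x (MvPolynomial.aeval f v)
      = MvPolynomial.eval (fun i => Polynomial.eval x (f i)) v := by
  induction v using MvPolynomial.induction_on with
  | C a => simp
  | add p q hp hq => simp [hp, hq]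
  | mul_X p i hp => simp [hp]

lemma aux_closed (d : ℕ) : IsClosed (unitSimplex d) := by
  have : unitSimplex d = (⋂ i, {x : Fin d → ℝ | 0 ≤ x i}) ∩ {x | ∑ i, x i ≤ 1} := by
    ext x; simp [unitSimplex]
  rw [this]
  refine (isClosed_iInter fun i => isClosed_le continuous_const (continuous_apply i)).inter ?_
  exact isClosed_le (by fun_prop) continuous_const

lemma aux_le_one {d : ℕ} {x : Fin d → ℝ} (hx : x ∈ unitSimplex d) (i : Fin d) : x i ≤ 1 :=
  (Finset.single_le_sum (fun i _ => hx.1 i) (Finset.mem_univ i)).trans hx.2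

lemma aux_compact (d : ℕ) : IsCompact (unitSimplex d) := by
  refine (isCompact_Icc (a := (0 : Fin d → ℝ)) (b := 1)).of_isClosed_subset (aux_closed d) ?_
  intro x hx
  exact ⟨fun i => hx.1 i, fun i => aux_le_one hx i⟩

lemma aux_cont {d : ℕ} (v : MvPolynomial (Fin d) ℝ) :
    Continuous fun x : Fin d → ℝ => (MvPolynomial.eval x v) ^ 2 :=
  (MvPolynomial.continuous_eval v).pow 2

lemma aux_int {d : ℕ} (v : MvPolynomial (Fin d) ℝ) (S : Set (Fin d → ℝ))
    (hS : S ⊆ unitSimplex d) :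
    IntegrableOn (fun x : Fin d → ℝ => (MvPolynomial.eval x v) ^ 2) S :=
  ((aux_cont v).continuousOn.integrableOn_compact (aux_compact d)).mono_set hS

/-- squared inverse inequality -/
def AuxP (p d : ℕ) (A : ℝ) : Prop :=
  ∀ v : MvPolynomial (Fin d) ℝ, v.totalDegree ≤ p → ∀ i : Fin d,
    ∫ x in unitSimplex d, (MvPolynomial.eval x (MvPolynomial.pderiv i v)) ^ 2
      ≤ A * ∫ x in unitSimplex d, (MvPolynomial.eval x v) ^ 2

open scoped Pointwise in
lemma aux_mem_slice {d : ℕ} (j : Fin (d + 1)) (c : ℝ) (hc0 : 0 ≤ c) (hc : c ≤ 1 / 2)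
    (y : Fin d → ℝ) :
    (j.insertNth c y : Fin (d + 1) → ℝ) ∈ unitSimplex (d + 1) ↔
      y ∈ (1 - c) • unitSimplex d := by
  have hs : 0 < 1 - c := by linarith
  rw [Set.mem_smul_set_iff_inv_smul_mem₀ hs.ne']
  simp only [unitSimplex, Set.mem_setOf_eq, Fin.forall_iff_succAbove j, Fin.insertNth_apply_same,
    Fin.insertNth_apply_succAbove, Fin.sum_univ_succAbove _ j, Pi.smul_apply, smul_eq_mul,
    ← Finset.mul_sum]
  refine and_congr ⟨fun h i => mul_nonneg (inv_pos.2 hs).le (h.2 i), fun h => ⟨hc0, fun i => ?_⟩⟩ ?_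
  · exact (mul_nonneg_iff_of_pos_left (inv_pos.2 hs)).1 (h i)
  · rw [inv_mul_le_iff₀ hs]
    constructor <;> intro h <;> linarith

open scoped Pointwise in
lemma aux_slice {p d : ℕ} {A : ℝ} (hA : 0 ≤ A) (hP : AuxP p d A)
    (v : MvPolynomial (Fin (d + 1)) ℝ) (hv : v.totalDegree ≤ p) (j : Fin (d + 1)) (i : Fin d)
    (c : ℝ) (hc0 : 0 ≤ c) (hc : c ≤ 1 / 2) :
    ∫ y in (1 - c) • unitSimplex d,
        (MvPolynomial.eval (j.insertNth c y : Fin (d + 1) → ℝ)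
          (MvPolynomial.pderiv (j.succAbove i) v)) ^ 2
      ≤ 4 * A * ∫ y in (1 - c) • unitSimplex d,
        (MvPolynomial.eval (j.insertNth c y : Fin (d + 1) → ℝ) v) ^ 2 := by
  have hs : 0 < 1 - c := by linarith
  set f : Fin (d + 1) → MvPolynomial (Fin d) ℝ :=
    j.insertNth (MvPolynomial.C c) (fun k => MvPolynomial.C (1 - c) * MvPolynomial.X k) with hf
  have hdeg : ∀ k, (f k).totalDegree ≤ 1 := by
    rw [Fin.forall_iff_succAbove j]
    refine ⟨by simp [hf], fun k => ?_⟩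
    simp only [hf, Fin.insertNth_apply_succAbove]
    refine (MvPolynomial.totalDegree_mul _ _).trans ?_
    rw [MvPolynomial.totalDegree_C, MvPolynomial.totalDegree_X]
  have hev : ∀ (w : MvPolynomial (Fin (d + 1)) ℝ) (y : Fin d → ℝ),
      MvPolynomial.eval y (MvPolynomial.aeval f w)
        = MvPolynomial.eval (j.insertNth c ((1 - c) • y) : Fin (d + 1) → ℝ) w := by
    intro w y
    rw [aux_eval_aeval]
    congr 2
    funext k
    revert k
    rw [Fin.forall_iff_succAbove j]
    exact ⟨by simp [hf], fun k => by simp [hf]⟩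
  have hder : MvPolynomial.pderiv i (MvPolynomial.aeval f v)
      = MvPolynomial.C (1 - c) * MvPolynomial.aeval f (MvPolynomial.pderiv (j.succAbove i) v) := by
    rw [aux_chain, Fin.sum_univ_succAbove _ j, Finset.sum_eq_single i]
    · simp [hf, mul_comm]
    · intro b _ hb
      simp [hf, MvPolynomial.pderiv_X, Pi.single_apply, hb, hb.symm]
    · simp
  have key := hP (MvPolynomial.aeval f v) ((aux_totalDegree f hdeg v).trans hv) i
  rw [hder] at key
  simp only [map_mul, MvPolynomial.eval_C, hev, mul_pow] at key
  rw [integral_const_mul,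
    Measure.setIntegral_comp_smul_of_pos volume (fun y => (MvPolynomial.eval
      (j.insertNth c y : Fin (d + 1) → ℝ) (MvPolynomial.pderiv (j.succAbove i) v)) ^ 2) _ hs,
    Measure.setIntegral_comp_smul_of_pos volume (fun y => (MvPolynomial.eval
      (j.insertNth c y : Fin (d + 1) → ℝ) v) ^ 2) _ hs] at key
  set I := ∫ y in (1 - c) • unitSimplex d, (MvPolynomial.eval
      (j.insertNth c y : Fin (d + 1) → ℝ) (MvPolynomial.pderiv (j.succAbove i) v)) ^ 2
  set J := ∫ y in (1 - c) • unitSimplex d, (MvPolynomial.eval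
      (j.insertNth c y : Fin (d + 1) → ℝ) v) ^ 2
  have hI : 0 ≤ I := integral_nonneg fun y => sq_nonneg _
  simp only [smul_eq_mul] at key
  have hq : 0 < ((1 - c) ^ Module.finrank ℝ (Fin d → ℝ))⁻¹ := by positivity
  have h2 : (1 - c) ^ 2 * I ≤ A * J := by
    refine le_of_mul_le_mul_left ?_ hq
    linarith
  nlinarith [mul_nonneg hI (show 0 ≤ (1 - c) ^ 2 - 1 / 4 by nlinarith)]

open scoped Pointwise in
lemma aux_half {p d : ℕ} {A : ℝ} (hA : 0 ≤ A) (hP : AuxP p d A)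
    (v : MvPolynomial (Fin (d + 1)) ℝ) (hv : v.totalDegree ≤ p) (j i : Fin (d + 1))
    (hij : i ≠ j) :
    ∫ x in unitSimplex (d + 1) ∩ {x | x j ≤ 1 / 2},
        (MvPolynomial.eval x (MvPolynomial.pderiv i v)) ^ 2
      ≤ 4 * A * ∫ x in unitSimplex (d + 1), (MvPolynomial.eval x v) ^ 2 := by
  obtain ⟨i, rfl⟩ := Fin.exists_succAbove_eq hij
  set S := unitSimplex (d + 1) ∩ {x | x j ≤ 1 / 2} with hS
  have hSK : S ⊆ unitSimplex (d + 1) := Set.inter_subset_left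
  have hSm : MeasurableSet S := by
    refine (aux_closed _).measurableSet.inter ?_
    exact measurableSet_le (measurable_pi_apply j) measurable_const
  have hmono : ∫ x in S, (MvPolynomial.eval x v) ^ 2
      ≤ ∫ x in unitSimplex (d + 1), (MvPolynomial.eval x v) ^ 2 :=
    setIntegral_mono_set (aux_int v _ subset_rfl) (Filter.Eventually.of_forall fun x => sq_nonneg _)
      (Filter.Eventually.of_forall hSK)
  refine le_trans ?_ (mul_le_mul_of_nonneg_left hmono (by positivity))
  have hmp := (volume_preserving_piFinSuccAbove (fun _ : Fin (d + 1) => ℝ) j).symm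
  have hfub : ∀ w : MvPolynomial (Fin (d + 1)) ℝ,
      Integrable (fun c : ℝ => ∫ y : Fin d → ℝ, S.indicator (fun x => (MvPolynomial.eval x w) ^ 2)
        (j.insertNth c y : Fin (d + 1) → ℝ)) ∧
      ∫ x in S, (MvPolynomial.eval x w) ^ 2
        = ∫ c : ℝ, ∫ y : Fin d → ℝ, S.indicator (fun x => (MvPolynomial.eval x w) ^ 2)
          (j.insertNth c y : Fin (d + 1) → ℝ) := by
    intro w
    have h1 : Integrable (S.indicator (fun x => (MvPolynomial.eval x w) ^ 2)) :=
      (integrable_indicator_iff hSm).2 (aux_int w S hSK)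
    have h2 := (hmp.integrable_comp_emb (MeasurableEquiv.measurableEmbedding _)).2 h1
    refine ⟨h2.integral_prod_left, ?_⟩
    rw [← integral_indicator hSm, ← hmp.integral_comp (MeasurableEquiv.measurableEmbedding _)]
    exact integral_prod _ h2
  rw [(hfub v).2, (hfub _).2, ← integral_const_mul]
  refine integral_mono (hfub _).1 ((hfub v).1.const_mul _) fun c => ?_
  by_cases hc : 0 ≤ c ∧ c ≤ 1 / 2
  · have hmem : ∀ y : Fin d → ℝ, (j.insertNth c y : Fin (d + 1) → ℝ) ∈ S ↔
        y ∈ (1 - c) • unitSimplex d := by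
      intro y
      rw [← aux_mem_slice j c hc.1 hc.2, hS]
      simp only [Set.mem_inter_iff, Set.mem_setOf_eq, Fin.insertNth_apply_same, hc.2, and_true]
    have hm : MeasurableSet ((1 - c) • unitSimplex d) :=
      (aux_closed d).measurableSet.const_smul₀ _
    have hind : ∀ w : MvPolynomial (Fin (d + 1)) ℝ,
        ∫ y : Fin d → ℝ, S.indicator (fun x => (MvPolynomial.eval x w) ^ 2)
          (j.insertNth c y : Fin (d + 1) → ℝ)
        = ∫ y in (1 - c) • unitSimplex d,
          (MvPolynomial.eval (j.insertNth c y : Fin (d + 1) → ℝ) w) ^ 2 := by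
      intro w
      rw [← integral_indicator hm]
      refine integral_congr_ae (Filter.Eventually.of_forall fun y => ?_)
      by_cases hy : y ∈ (1 - c) • unitSimplex d
      · exact (Set.indicator_of_mem ((hmem y).2 hy) _).trans (Set.indicator_of_mem hy
          (fun y => (MvPolynomial.eval (j.insertNth c y : Fin (d + 1) → ℝ) w) ^ 2)).symm
      · exact (Set.indicator_of_notMem (fun h => hy ((hmem y).1 h)) _).trans
          (Set.indicator_of_notMem hy _).symm
    have := aux_slice hA hP v hv j i c hc.1 hc.2
    rw [← hind, ← hind] at this
    exact this
  · have hmem : ∀ y : Fin d → ℝ, (j.insertNth c y : Fin (d + 1) → ℝ) ∉ S := by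
      intro y hy
      apply hc
      have h1 := hy.1.1 j
      have h2 := hy.2
      simp only [Set.mem_setOf_eq, Fin.insertNth_apply_same] at h1 h2
      exact ⟨h1, h2⟩
    simp [Set.indicator_of_notMem (hmem _)]

lemma aux_union {d : ℕ} (w : MvPolynomial (Fin d) ℝ) (S T : Set (Fin d → ℝ))
    (hS : S ⊆ unitSimplex d) (hT : T ⊆ unitSimplex d) (hSm : MeasurableSet S)
    (hST : unitSimplex d ⊆ S ∪ T) :
    ∫ x in unitSimplex d, (MvPolynomial.eval x w) ^ 2 ≤
      (∫ x in S, (MvPolynomial.eval x w) ^ 2) + ∫ x in T, (MvPolynomial.eval x w) ^ 2 := by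
  rw [← integral_inter_add_diff hSm (aux_int w _ subset_rfl)]
  refine add_le_add ?_ ?_
  · exact setIntegral_mono_set (aux_int w _ hS) (Filter.Eventually.of_forall fun x => sq_nonneg _)
      (Filter.Eventually.of_forall Set.inter_subset_right)
  · refine setIntegral_mono_set (aux_int w _ hT) (Filter.Eventually.of_forall fun x => sq_nonneg _)
      (Filter.Eventually.of_forall ?_)
    rintro x ⟨hx, hxS⟩
    exact (hST hx).resolve_left hxS

lemma aux_meas {d : ℕ} (j : Fin d) :
    MeasurableSet (unitSimplex d ∩ {x | x j ≤ 1 / 2}) :=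
  (aux_closed _).measurableSet.inter (measurableSet_le (measurable_pi_apply j) measurable_const)

lemma aux_two_le {d : ℕ} {x : Fin d → ℝ} (hx : x ∈ unitSimplex d) {j k : Fin d} (hjk : j ≠ k) :
    x j + x k ≤ 1 := by
  refine le_trans ?_ hx.2
  rw [← Finset.sum_pair hjk]
  exact Finset.sum_le_sum_of_subset_of_nonneg (Finset.subset_univ _) fun i _ _ => hx.1 i

lemma aux_step {p d : ℕ} (hd : 2 ≤ d) {A : ℝ} (hA : 0 ≤ A) (hP : AuxP p d A) :
    AuxP p (d + 1) (8 * A) := by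
  intro v hv i
  obtain ⟨j, hj, k, hk, hjk⟩ : ∃ j, i ≠ j ∧ ∃ k, i ≠ k ∧ j ≠ k := by
    refine ⟨i.succAbove ⟨0, by omega⟩, (Fin.succAbove_ne _ _).symm,
      i.succAbove ⟨1, by omega⟩, (Fin.succAbove_ne _ _).symm, ?_⟩
    rw [Ne, Fin.succAbove_right_inj]
    simp
  have h1 := aux_half hA hP v hv j i hj
  have h2 := aux_half hA hP v hv k i hk
  have h3 := aux_union (MvPolynomial.pderiv i v) _ (unitSimplex (d + 1) ∩ {x | x k ≤ 1 / 2})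
    Set.inter_subset_left Set.inter_subset_left (aux_meas j) (fun x hx => by
      have := aux_two_le hx hjk
      rcases le_total (x j) (1 / 2) with h | h
      · exact Or.inl ⟨hx, h⟩
      · refine Or.inr ⟨hx, ?_⟩
        simp only [Set.mem_setOf_eq]
        linarith)
  linarith

lemma aux_one {p : ℕ} {C1 : ℝ} (h0 : 0 ≤ C1)
    (h : ∀ v : Polynomial ℝ, v.natDegree ≤ p →
      Real.sqrt (∫ x in Set.Ioo (0:ℝ) 1, ((Polynomial.derivative v).eval x) ^ 2) ≤
        C1 * Real.sqrt (∫ x in Set.Ioo (0:ℝ) 1, (v.eval x) ^ 2)) : AuxP p 1 (C1 ^ 2) := by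
  intro v hv i
  set f : Fin 1 → Polynomial ℝ := fun _ => Polynomial.X with hf
  have hmp := (volume_preserving_funUnique (Fin 1) ℝ).symm
  have hint : ∀ w : MvPolynomial (Fin 1) ℝ, ∫ x in unitSimplex 1, (MvPolynomial.eval x w) ^ 2
      = ∫ x in Set.Ioo (0:ℝ) 1, ((MvPolynomial.aeval f w).eval x) ^ 2 := by
    intro w
    refine (hmp.setIntegral_preimage_emb (MeasurableEquiv.measurableEmbedding _)
      (fun x => (MvPolynomial.eval x w) ^ 2) (unitSimplex 1)).symm.trans ?_
    rw [← integral_Icc_eq_integral_Ioo]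
    have : (MeasurableEquiv.funUnique (Fin 1) ℝ).symm ⁻¹' unitSimplex 1 = Set.Icc 0 1 := by
      ext t
      simp [unitSimplex, MeasurableEquiv.funUnique, uniqueElim_const]
    rw [this]
    refine integral_congr_ae (Filter.Eventually.of_forall fun t => ?_)
    simp only [aux_eval_aeval', hf, Polynomial.eval_X]
    rfl
  have hder : MvPolynomial.aeval f (MvPolynomial.pderiv i v)
      = Polynomial.derivative (MvPolynomial.aeval f v) := by
    have := aux_chain (Polynomial.derivative' (R := ℝ)) f v
    simp only [Polynomial.derivative'_apply, hf, Polynomial.derivative_X] at this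
    rw [this, Fin.sum_univ_one, mul_one, Subsingleton.elim i 0]
  rw [hint, hint, hder]
  have key := h (MvPolynomial.aeval f v)
    ((aux_natDegree f (fun _ => by simp [hf]) v).trans hv)
  have hI : 0 ≤ ∫ x in Set.Ioo (0:ℝ) 1,
      ((Polynomial.derivative (MvPolynomial.aeval f v)).eval x) ^ 2 :=
    integral_nonneg fun _ => sq_nonneg _
  have hJ : 0 ≤ ∫ x in Set.Ioo (0:ℝ) 1, ((MvPolynomial.aeval f v).eval x) ^ 2 :=
    integral_nonneg fun _ => sq_nonneg _
  have k2 := pow_le_pow_left₀ (Real.sqrt_nonneg _) key 2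
  rwa [mul_pow, Real.sq_sqrt hI, Real.sq_sqrt hJ] at k2

/-- The affine involution of the triangle that fixes the vertex `e_i` and swaps the others. -/
def auxT (i j : Fin 2) (x : Fin 2 → ℝ) : Fin 2 → ℝ :=
  fun k => if k = j then 1 - x i - x j else x k

lemma auxT_invol {i j : Fin 2} (hij : i ≠ j) (x : Fin 2 → ℝ) : auxT i j (auxT i j x) = x := by
  funext k
  by_cases hk : k = j
  · subst hk; simp [auxT, hij]
  · simp [auxT, hk]

lemma auxT_mp {i j : Fin 2} (hij : i ≠ j) : MeasurePreserving (auxT i j) := by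
  set L : (Fin 2 → ℝ) →ₗ[ℝ] (Fin 2 → ℝ) :=
    Matrix.toLin' (Matrix.of fun a b => if a = j then (-1 : ℝ) else if a = b then 1 else 0) with hL
  have hdet : LinearMap.det L = -1 := by
    rw [hL, LinearMap.det_toLin', Matrix.det_fin_two]
    fin_cases i <;> fin_cases j <;> simp_all
  have h1 : MeasurePreserving L volume volume := by
    refine ⟨L.continuous_of_finiteDimensional.measurable, ?_⟩
    rw [Real.map_linearMap_volume_pi_eq_smul_volume_pi (by rw [hdet]; norm_num), hdet]
    norm_num
  have h2 := measurePreserving_add_left (volume : Measure (Fin 2 → ℝ)) (Pi.single j 1)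
  have h3 := h2.comp h1
  suffices h4 : auxT i j = (fun x => Pi.single j 1 + x) ∘ L by
    rw [h4]; exact h3
  funext x k
  simp only [Function.comp, hL, auxT, Matrix.toLin'_apply, Matrix.mulVec, dotProduct,
    Fin.sum_univ_two, Matrix.of_apply, Pi.add_apply, Pi.single_apply]
  fin_cases i <;> fin_cases j <;> fin_cases k <;> simp_all <;> ring

lemma auxT_mem {i j : Fin 2} (hij : i ≠ j) (x : Fin 2 → ℝ) :
    auxT i j x ∈ unitSimplex 2 ↔ x ∈ unitSimplex 2 := by
  simp only [unitSimplex, auxT, Set.mem_setOf_eq, Fin.forall_fin_two, Fin.sum_univ_two]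
  fin_cases i <;> fin_cases j <;> simp at hij ⊢ <;> constructor <;> rintro ⟨⟨h1, h2⟩, h3⟩ <;>
    refine ⟨⟨?_, ?_⟩, ?_⟩ <;> linarith

lemma aux_two {p : ℕ} {A : ℝ} (hA : 0 ≤ A) (hP : AuxP p 1 A) : AuxP p 2 (20 * A) := by
  intro v hv i
  obtain ⟨j, hij⟩ : ∃ j : Fin 2, i ≠ j := ⟨i + 1, by fin_cases i <;> simp⟩
  set V := ∫ x in unitSimplex 2, (MvPolynomial.eval x v) ^ 2 with hV
  have h1 := aux_half (d := 1) hA hP v hv j i hij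
  have h2 := aux_half (d := 1) hA hP v hv i j hij.symm
  -- the substituted polynomial
  set f : Fin 2 → MvPolynomial (Fin 2) ℝ := fun k =>
    if k = j then 1 - MvPolynomial.X i - MvPolynomial.X j else MvPolynomial.X k with hf
  have hdeg : ∀ k, (f k).totalDegree ≤ 1 := by
    intro k
    simp only [hf]
    split_ifs
    · refine (MvPolynomial.totalDegree_sub _ _).trans (max_le
        ((MvPolynomial.totalDegree_sub _ _).trans (max_le ?_ ?_)) ?_) <;> simp
    · simp
  have hev : ∀ (w : MvPolynomial (Fin 2) ℝ) (y : Fin 2 → ℝ),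
      MvPolynomial.eval y (MvPolynomial.aeval f w) = MvPolynomial.eval (auxT i j y) w := by
    intro w y
    rw [aux_eval_aeval]
    congr 2
    funext k
    simp only [hf, auxT]
    split_ifs <;> simp
  have hder : MvPolynomial.pderiv i (MvPolynomial.aeval f v)
      = MvPolynomial.aeval f (MvPolynomial.pderiv i v - MvPolynomial.pderiv j v) := by
    rw [aux_chain, map_sub]
    have : (Finset.univ : Finset (Fin 2)) = {i, j} := by
      fin_cases i <;> fin_cases j <;> simp at hij ⊢ <;> decide
    rw [this, Finset.sum_pair hij]
    simp [hf, hij, hij.symm, MvPolynomial.pderiv_X, Pi.single_apply]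
    ring
  have h3 := aux_half (d := 1) hA hP (MvPolynomial.aeval f v)
    ((aux_totalDegree f hdeg v).trans hv) j i hij
  have hemb : MeasurableEmbedding (auxT i j) := by
    have hm := (auxT_mp hij).measurable
    exact (MeasurableEquiv.mk ⟨auxT i j, auxT i j, auxT_invol hij, auxT_invol hij⟩ hm
      hm).measurableEmbedding
  rw [hder] at h3
  simp only [hev] at h3
  have hpre1 : auxT i j ⁻¹' unitSimplex 2 = unitSimplex 2 := by
    ext x; exact auxT_mem hij x
  have hpre2 : auxT i j ⁻¹' (unitSimplex 2 ∩ {x | 1 / 2 ≤ x i + x j})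
      = unitSimplex 2 ∩ {x | x j ≤ 1 / 2} := by
    ext x
    simp only [Set.mem_preimage, Set.mem_inter_iff, auxT_mem hij, Set.mem_setOf_eq]
    refine and_congr_right fun _ => ?_
    simp only [auxT, hij, if_true, if_false]
    constructor <;> intro h <;> linarith
  have e1 := (auxT_mp hij).setIntegral_preimage_emb hemb
    (fun x => (MvPolynomial.eval x v) ^ 2) (unitSimplex 2)
  have e2 := (auxT_mp hij).setIntegral_preimage_emb hemb
    (fun x => (MvPolynomial.eval x (MvPolynomial.pderiv i v - MvPolynomial.pderiv j v)) ^ 2)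
    (unitSimplex 2 ∩ {x | 1 / 2 ≤ x i + x j})
  rw [hpre1] at e1
  rw [hpre2] at e2
  simp only [Nat.reduceAdd] at h1 h2 h3
  rw [e1, e2] at h3
  set T := unitSimplex 2 ∩ {x | 1 / 2 ≤ x j} with hT
  have hTK : T ⊆ unitSimplex 2 := Set.inter_subset_left
  have h4 := aux_union (MvPolynomial.pderiv i v) _ T Set.inter_subset_left hTK
    (aux_meas j) (fun x hx => by
      rcases le_total (x j) (1 / 2) with h | h
      · exact Or.inl ⟨hx, h⟩
      · exact Or.inr ⟨hx, h⟩)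
  have h5 : ∫ x in T, (MvPolynomial.eval x (MvPolynomial.pderiv i v)) ^ 2 ≤
      ∫ x in T, (2 * (MvPolynomial.eval x
        (MvPolynomial.pderiv i v - MvPolynomial.pderiv j v)) ^ 2
        + 2 * (MvPolynomial.eval x (MvPolynomial.pderiv j v)) ^ 2) := by
    refine integral_mono (aux_int _ T hTK)
      (((aux_int _ T hTK).const_mul 2).add ((aux_int _ T hTK).const_mul 2)) fun x => ?_
    simp only [map_sub]
    nlinarith [sq_nonneg (MvPolynomial.eval x (MvPolynomial.pderiv i v)
      - 2 * MvPolynomial.eval x (MvPolynomial.pderiv j v))]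
  rw [integral_add ((aux_int _ T hTK).const_mul 2) ((aux_int _ T hTK).const_mul 2),
    integral_const_mul, integral_const_mul] at h5
  have h6 : ∫ x in T, (MvPolynomial.eval x (MvPolynomial.pderiv j v)) ^ 2 ≤
      ∫ x in unitSimplex 2 ∩ {x | x i ≤ 1 / 2},
        (MvPolynomial.eval x (MvPolynomial.pderiv j v)) ^ 2 := by
    refine setIntegral_mono_set (aux_int _ _ Set.inter_subset_left)
      (Filter.Eventually.of_forall fun x => sq_nonneg _) (Filter.Eventually.of_forall ?_)
    rintro x ⟨hx, hxj⟩
    refine ⟨hx, ?_⟩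
    have := aux_two_le hx hij
    simp only [Set.mem_setOf_eq] at hxj ⊢
    linarith
  have h7 : ∫ x in T, (MvPolynomial.eval x
        (MvPolynomial.pderiv i v - MvPolynomial.pderiv j v)) ^ 2 ≤
      ∫ x in unitSimplex 2 ∩ {x | 1 / 2 ≤ x i + x j}, (MvPolynomial.eval x
        (MvPolynomial.pderiv i v - MvPolynomial.pderiv j v)) ^ 2 := by
    refine setIntegral_mono_set (aux_int _ _ Set.inter_subset_left)
      (Filter.Eventually.of_forall fun x => sq_nonneg _) (Filter.Eventually.of_forall ?_)
    rintro x ⟨hx, hxj⟩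
    refine ⟨hx, ?_⟩
    have := hx.1 i
    simp only [Set.mem_setOf_eq] at hxj ⊢
    linarith
  linarith

lemma aux_all {p : ℕ} {A : ℝ} (hA : 0 ≤ A) (hP : AuxP p 1 A) (d : ℕ) (hd : 2 ≤ d) :
    AuxP p d (5 / 16 * 8 ^ d * A) := by
  induction d, hd using Nat.le_induction with
  | base =>
    have := aux_two hA hP
    convert this using 1
    ring
  | succ d hd ih =>
    have := aux_step hd (by positivity) ih
    convert this using 1
    ring

lemma aux_all' {p : ℕ} {A : ℝ} (hA : 0 ≤ A) (hP : AuxP p 1 A) (d : ℕ) (hd : 1 ≤ d) :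
    AuxP p d (5 / 16 * 8 ^ d * A) := by
  rcases hd.eq_or_lt with rfl | hd
  · intro v hv i
    refine (hP v hv i).trans (mul_le_mul_of_nonneg_right (by linarith) ?_)
    exact integral_nonneg fun _ => sq_nonneg _
  · exact aux_all hA hP d hd

/-- If `C1` is the best constant in the inverse inequality for degree-`p` polynomials on the
unit interval and `Cd` is the best constant for the unit simplex in `ℝ^d`, then
`Cd ≤ (√5/4)(2√2)^d C1`. -/
theorem inverse_inequality_unit_simplex_constant (d p : ℕ) (hd : 1 ≤ d) (C1 Cd : ℝ)
    (hC1 : IsLeast {C : ℝ | 0 ≤ C ∧ ∀ v : Polynomial ℝ, v.natDegree ≤ p →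
      Real.sqrt (∫ x in Set.Ioo (0:ℝ) 1, ((Polynomial.derivative v).eval x) ^ 2) ≤
        C * Real.sqrt (∫ x in Set.Ioo (0:ℝ) 1, (v.eval x) ^ 2)} C1)
    (hCd : IsLeast {C : ℝ | 0 ≤ C ∧ ∀ v : MvPolynomial (Fin d) ℝ, v.totalDegree ≤ p →
      ∀ i : Fin d,
      Real.sqrt (∫ x in unitSimplex d,
          (MvPolynomial.eval x (MvPolynomial.pderiv i v)) ^ 2) ≤
        C * Real.sqrt (∫ x in unitSimplex d, (MvPolynomial.eval x v) ^ 2)} Cd) :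
    Cd ≤ Real.sqrt 5 / 4 * (2 * Real.sqrt 2) ^ d * C1 := by
  have hP := aux_all' (sq_nonneg C1) (aux_one hC1.1.1 hC1.1.2) d hd
  have hC : 0 ≤ C1 := hC1.1.1
  refine hCd.2 ⟨by positivity, fun v hv i => ?_⟩
  have hsq : (Real.sqrt 5 / 4 * (2 * Real.sqrt 2) ^ d * C1) ^ 2 = 5 / 16 * 8 ^ d * C1 ^ 2 := by
    rw [mul_pow, mul_pow, div_pow, Real.sq_sqrt (by norm_num), ← pow_mul, mul_comm d 2, pow_mul,
      mul_pow, Real.sq_sqrt (by norm_num)]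
    norm_num
  refine Real.sqrt_le_iff.2 ⟨by positivity, ?_⟩
  rw [mul_pow, hsq, Real.sq_sqrt (integral_nonneg fun _ => sq_nonneg _)]
  exact hP v hv i
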